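/- Let X be an orthoset such that for every orthoclosed subset A of X the inclusion map ι : A → X is adjointable, i.e., there exists σ : X → A such that for all a ∈ A and x ∈ X, a ⊥ x iff a ⊥ σ(x). Then: (i) C(X) is orthomodular, i.e., for all orthoclosed A ⊆ B one has B = (A ∪ (B ∩ A⊥))⊥⊥; (ii) if moreover X is atomistic, then C(X) has the covering property: for every orthoclosed A and every proper x ∉ A, the join (A ∪ {x})⊥⊥ covers A in C(X). -/

import Mathlib

/-- An orthoset (with 0). -/
structure OrthoRel (X : Type*) where
  perp : X → X → Prop
  zero : X
  symm : ∀ x y, perp x y → perp y x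
  perp_self_iff : ∀ x, perp x x ↔ x = zero
  zero_perp : ∀ x, perp zero x

/-- Orthocomplement of a set with respect to a relation. -/
def ocl {X : Type*} (p : X → X → Prop) (A : Set X) : Set X := {x | ∀ y ∈ A, p x y}

/-- A set is orthoclosed if it equals its double orthocomplement. -/
def IsOrthoclosed {X : Type*} (p : X → X → Prop) (A : Set X) : Prop :=
  A = ocl p (ocl p A)

/-- `X` is atomistic. -/
def Atomistic {X : Type*} (O : OrthoRel X) : Prop :=
  ∀ x y : X, x ≠ O.zero → y ≠ O.zero →
    (∃ z, O.perp z x ∧ ¬ O.perp z y) → ∃ z', O.perp z' y ∧ ¬ O.perp z' x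

theorem ocl_anti {X : Type*} (p : X → X → Prop) {A B : Set X} (hAB : A ⊆ B) :
    ocl p B ⊆ ocl p A :=
  fun _ hx y hy => hx y (hAB hy)

namespace OrthoRel

variable {X : Type*} (O : OrthoRel X)

theorem subset_ocl_ocl (A : Set X) : A ⊆ ocl O.perp (ocl O.perp A) :=
  fun x hx y hy => O.symm y x (hy x hx)

theorem isOrthoclosed_ocl (A : Set X) : IsOrthoclosed O.perp (ocl O.perp A) :=
  Set.Subset.antisymm (O.subset_ocl_ocl _) (ocl_anti O.perp (O.subset_ocl_ocl A))

variable {O}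

theorem ocl_ocl_subset {A B : Set X} (hB : IsOrthoclosed O.perp B) (hAB : A ⊆ B) :
    ocl O.perp (ocl O.perp A) ⊆ B := by
  rw [hB]
  exact ocl_anti O.perp (ocl_anti O.perp hAB)

/-- If the inclusion of `B` is adjointable, an orthoclosed subset of `B` with trivial relative
orthocomplement is all of `B`. -/
theorem subset_of_relative_ocl_trivial {A B : Set X}
    (h : ∃ σ : X → {b : X // b ∈ B}, ∀ b ∈ B, ∀ x : X, O.perp b x ↔ O.perp b (σ x).1)
    (hA : IsOrthoclosed O.perp A) (hAB : A ⊆ B)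
    (h0 : ∀ y ∈ B, y ∈ ocl O.perp A → y = O.zero) : B ⊆ A := by
  obtain ⟨σ, hσ⟩ := h
  intro b hb
  rw [hA]
  intro y hy
  have hσy : (σ y).1 = O.zero := h0 _ (σ y).2 fun a ha =>
    O.symm _ _ ((hσ a (hAB ha) y).1 (O.symm _ _ (hy a ha)))
  rw [hσ b hb y, hσy]
  exact O.symm _ _ (O.zero_perp b)

end OrthoRel

open OrthoRel in
/-- Theorem 4.10: if for every orthoclosed `A ⊆ X` the inclusion map `A → X` is
adjointable, then (i) `C(X)` is orthomodular (X is Dacey), and (ii) if moreover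
`X` is atomistic, then `C(X)` has the covering property. -/
theorem stmt18 {X : Type*} (O : OrthoRel X)
    (h : ∀ A : Set X, IsOrthoclosed O.perp A →
      ∃ σ : X → {a : X // a ∈ A}, ∀ a ∈ A, ∀ x : X, O.perp a x ↔ O.perp a (σ x).1) :
    -- (i) C(X) is orthomodular
    (∀ A B : Set X, IsOrthoclosed O.perp A → IsOrthoclosed O.perp B → A ⊆ B →
      B = ocl O.perp (ocl O.perp (A ∪ (B ∩ ocl O.perp A)))) ∧
    -- (ii) covering property
    (Atomistic O →
      ∀ A : Set X, IsOrthoclosed O.perp A → ∀ x : X, x ≠ O.zero → x ∉ A →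
        (A ⊂ ocl O.perp (ocl O.perp (A ∪ {x})) ∧
          ∀ C : Set X, IsOrthoclosed O.perp C → A ⊆ C →
            C ⊆ ocl O.perp (ocl O.perp (A ∪ {x})) →
            C = A ∨ C = ocl O.perp (ocl O.perp (A ∪ {x})))) := by
  refine ⟨fun A B hA hB hAB => ?_, fun hat A hA x hx hxA => ⟨?_, fun C hC hAC hCx => ?_⟩⟩
  · have hsub : A ∪ (B ∩ ocl O.perp A) ⊆ B :=
      Set.union_subset hAB Set.inter_subset_left
    refine Set.Subset.antisymm ?_ (ocl_ocl_subset hB hsub)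
    refine subset_of_relative_ocl_trivial (h B hB) (O.isOrthoclosed_ocl _)
      (ocl_ocl_subset hB hsub) fun y hyB hy => ?_
    have hy' := ocl_anti O.perp (O.subset_ocl_ocl _) hy
    have hyA : y ∈ ocl O.perp A := ocl_anti O.perp Set.subset_union_left hy'
    exact (O.perp_self_iff y).1 (hy' y (Or.inr ⟨hyB, hyA⟩))
  · exact ⟨Set.subset_union_left.trans (O.subset_ocl_ocl _),
      fun hsub => hxA (hsub (O.subset_ocl_ocl _ (Or.inr rfl)))⟩
  · by_cases hCA : C ⊆ A
    · exact Or.inl (Set.Subset.antisymm hCA hAC)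
    refine Or.inr (Set.Subset.antisymm hCx ?_)
    obtain ⟨c, hcC, hcA, hc0⟩ : ∃ c ∈ C, c ∈ ocl O.perp A ∧ c ≠ O.zero := by
      by_contra! hcon
      exact hCA (subset_of_relative_ocl_trivial (h C hC) hA hAC hcon)
    obtain ⟨σ, hσ⟩ := h (ocl O.perp A) (O.isOrthoclosed_ocl A)
    obtain ⟨p, hpA, hσ⟩ :
        ∃ p ∈ ocl O.perp A, ∀ a ∈ ocl O.perp A, O.perp a x ↔ O.perp a p :=
      ⟨_, (σ x).2, fun a ha => hσ a ha x⟩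
    have hocl : ocl O.perp (A ∪ {x}) = ocl O.perp (A ∪ {p}) := by
      ext a
      simp only [ocl, Set.mem_ofPred_eq, Set.mem_union, Set.mem_singleton_iff, or_imp,
        forall_and, forall_eq]
      exact and_congr_right (hσ a)
    have hp0 : p ≠ O.zero := by
      rintro rfl
      refine hxA ?_
      rw [hA]
      exact fun y hy => O.symm _ _ ((hσ y hy).2 (O.symm _ _ (O.zero_perp y)))
    rw [hocl] at hCx ⊢
    have hcp : c ∈ ocl O.perp (ocl O.perp {p}) := by
      have hF := O.isOrthoclosed_ocl (A ∪ ocl O.perp (A ∪ {p}))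
      refine subset_of_relative_ocl_trivial (h _ hF) (O.isOrthoclosed_ocl _)
        (ocl_ocl_subset hF ?_) (fun y hy hyp => ?_) ?_
      · rintro _ rfl y (hy | hy)
        · exact hpA y hy
        · exact O.symm _ _ (hy _ (Or.inr rfl))
      · refine (O.perp_self_iff y).1 (hy y (Or.inr ?_))
        rintro z (hz | rfl)
        · exact hy z (Or.inl hz)
        · exact hyp _ (O.subset_ocl_ocl _ rfl)
      · rintro y (hy | hy)
        · exact hcA y hy
        · exact hCx hcC y hy
    have hpC : p ∈ C := by
      rw [hC]
      intro y hy
      by_contra hpy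
      obtain ⟨z, hzp, hzc⟩ := hat c p hc0 hp0
        ⟨y, hy c hcC, fun hyp => hpy (O.symm _ _ hyp)⟩
      exact hzc (O.symm _ _ (hcp z (by rintro _ rfl; exact hzp)))
    exact ocl_ocl_subset hC (Set.union_subset hAC (Set.singleton_subset_iff.2 hpC))
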